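/- For any uncountable cardinal κ, if P is a partition of the product space κ^ω (κ discrete) into second-countable subspaces, then |P| ≥ cf[κ]^ω. In particular par(κ^ω) ≥ cf[κ]^ω, and if cf(κ) = ω then par(κ^ω) ≥ κ⁺. -/

import Mathlib

open Cardinal Set

/-- The set of coordinates of members of `p`. -/
def stmtCoords {α : Type*} (p : Set (ℕ → α)) : Set α := ⋃ n : ℕ, (fun x : ℕ → α => x n) '' p

theorem stmtCoords_countable {α : Type*} [TopologicalSpace α] [DiscreteTopology α]
    (p : Set (ℕ → α)) (hp : SecondCountableTopology p) : (stmtCoords p).Countable := by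
  refine countable_iUnion fun n => ?_
  have h1 : TopologicalSpace.IsSeparable p := TopologicalSpace.IsSeparable.of_subtype p
  obtain ⟨c, hc, hsub⟩ := h1.image (continuous_apply n : Continuous fun x : ℕ → α => x n)
  rw [closure_discrete] at hsub
  exact hc.mono hsub

theorem stmt_first {α : Type*} [TopologicalSpace α] [DiscreteTopology α]
    (hα : ℵ₀ < #α) (P : Set (Set (ℕ → α)))
    (hU : ⋃₀ P = Set.univ) (hP : ∀ p ∈ P, SecondCountableTopology p) :
      sInf {c : Cardinal | ∃ F : Set (Set α),
        (∀ A ∈ F, A.Countable ∧ A.Infinite) ∧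
        (∀ X : Set α, X.Countable → X.Infinite → ∃ A ∈ F, X ⊆ A) ∧ #F = c} ≤ #P := by
  have : Infinite α := Cardinal.infinite_iff.2 hα.le
  let g : ℕ ↪ α := Infinite.natEmbedding α
  let F : Set (Set α) := (fun p => stmtCoords p ∪ range g) '' P
  refine le_trans (csInf_le' ⟨F, ?_, ?_, rfl⟩) (mk_image_le (f := fun p => stmtCoords p ∪ range g))
  · rintro _ ⟨p, hp, rfl⟩
    exact ⟨(stmtCoords_countable p (hP p hp)).union (countable_range g),
      (infinite_range_of_injective g.injective).mono subset_union_right⟩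
  · intro X hX hXi
    obtain ⟨x, rfl⟩ := hX.exists_eq_range hXi.nonempty
    obtain ⟨p, hp, hx⟩ : x ∈ ⋃₀ P := hU ▸ mem_univ x
    refine ⟨_, ⟨p, hp, rfl⟩, ?_⟩
    rintro _ ⟨n, rfl⟩
    exact Or.inl (mem_iUnion.2 ⟨n, x, hx, rfl⟩)

theorem stmt_diag {α : Type*} [TopologicalSpace α] [DiscreteTopology α]
    (hα : ℵ₀ < #α) (hcof : (#α).ord.cof = ℵ₀) (P : Set (Set (ℕ → α)))
    (hU : ⋃₀ P = Set.univ) (hP : ∀ p ∈ P, SecondCountableTopology p) :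
      #α < #P := by
  by_contra! hle
  obtain ⟨s, hs, hsc⟩ := Order.exists_cof_eq (α := (#α).ord.ToType)
  rw [Ordinal.cof_toType, hcof] at hsc
  have hsct : s.Countable := by rw [← Cardinal.le_aleph0_iff_set_countable, hsc]
  have hne : s.Nonempty := by
    rw [nonempty_iff_ne_empty]; rintro rfl; simp at hsc; exact aleph0_ne_zero hsc.symm
  obtain ⟨e, rfl⟩ := hsct.exists_eq_range hne
  have hle' : #P ≤ #((#α).ord.ToType) := by rwa [mk_ord_toType]
  obtain ⟨f⟩ := hle'
  have key : ∀ n, ∃ a : α, ∀ p : P, f p ≤ e n → a ∉ stmtCoords p.1 := by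
    intro n
    have h1 : #(Iic (e n)) < #α := by
      rw [← Iio_insert]
      exact (mk_insert_le).trans_lt
        (add_lt_of_lt hα.le (mk_Iio_toType_ord_lt _) (one_lt_aleph0.trans hα))
    have h2 : #{p : P // f p ≤ e n} < #α := by
      refine lt_of_le_of_lt ?_ h1
      exact mk_le_of_injective (f := fun p => (⟨f p.1, p.2⟩ : Iic (e n))) (by
        intro p q h
        exact Subtype.ext (f.injective (congrArg Subtype.val h)))
    have h3 : #(⋃ p : {p : P // f p ≤ e n}, stmtCoords p.1.1) < #α := by
      refine (mk_iUnion_le _).trans_lt (mul_lt_of_lt hα.le h2 ?_)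
      refine lt_of_le_of_lt (ciSup_le' fun p => ?_) hα
      exact (stmtCoords_countable _ (hP _ p.1.2)).le_aleph0
    by_contra! hcon
    have : (⋃ p : {p : P // f p ≤ e n}, stmtCoords p.1.1) = Set.univ := by
      refine eq_univ_of_forall fun a => ?_
      obtain ⟨p, hp, ha⟩ := hcon a
      exact mem_iUnion.2 ⟨⟨p, hp⟩, ha⟩
    rw [this, mk_univ] at h3
    exact h3.false
  choose x hx using key
  obtain ⟨p, hp, hxp⟩ : x ∈ ⋃₀ P := hU ▸ mem_univ x
  obtain ⟨_, ⟨n, rfl⟩, hn⟩ := hs (f ⟨p, hp⟩)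
  exact hx n ⟨p, hp⟩ hn (mem_iUnion.2 ⟨n, x, hxp, rfl⟩)

theorem stmt_nonempty {α : Type*} [TopologicalSpace α] [DiscreteTopology α] :
    {c : Cardinal | ∃ P : Set (Set (ℕ → α)),
        (∀ p ∈ P, ∀ q ∈ P, p ≠ q → Disjoint p q) ∧ (∀ p ∈ P, p.Nonempty) ∧
        ⋃₀ P = Set.univ ∧ (∀ p ∈ P, PolishSpace p) ∧ #P = c}.Nonempty := by
  refine ⟨_, range (fun x : ℕ → α => ({x} : Set (ℕ → α))), ?_, ?_, ?_, ?_, rfl⟩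
  · rintro _ ⟨x, rfl⟩ _ ⟨y, rfl⟩ h
    exact disjoint_singleton.2 fun hxy => h (by rw [hxy])
  · rintro _ ⟨x, rfl⟩
    exact singleton_nonempty x
  · exact eq_univ_of_forall fun x => ⟨{x}, ⟨x, rfl⟩, rfl⟩
  · rintro _ ⟨x, rfl⟩
    have : DiscreteTopology ({x} : Set (ℕ → α)) := inferInstance
    have : Countable ({x} : Set (ℕ → α)) := inferInstance
    show PolishSpace ({x} : Set (ℕ → α))
    infer_instance

/-- For an uncountable discrete space α: any partition of α^ω into second-countable
subspaces has cardinality at least cf[α]^ω; in particular par(α^ω) ≥ cf[α]^ω, and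
if cf(|α|) = ω then par(α^ω) ≥ |α|⁺. -/
theorem stmt_14 {α : Type*} [TopologicalSpace α] [DiscreteTopology α]
    (hα : ℵ₀ < #α) :
    (∀ P : Set (Set (ℕ → α)),
      (∀ p ∈ P, ∀ q ∈ P, p ≠ q → Disjoint p q) → (∀ p ∈ P, p.Nonempty) →
      ⋃₀ P = Set.univ → (∀ p ∈ P, SecondCountableTopology p) →
      sInf {c : Cardinal | ∃ F : Set (Set α),
        (∀ A ∈ F, A.Countable ∧ A.Infinite) ∧
        (∀ X : Set α, X.Countable → X.Infinite → ∃ A ∈ F, X ⊆ A) ∧ #F = c} ≤ #P) ∧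
    sInf {c : Cardinal | ∃ F : Set (Set α),
        (∀ A ∈ F, A.Countable ∧ A.Infinite) ∧
        (∀ X : Set α, X.Countable → X.Infinite → ∃ A ∈ F, X ⊆ A) ∧ #F = c} ≤
      sInf {c : Cardinal | ∃ P : Set (Set (ℕ → α)),
        (∀ p ∈ P, ∀ q ∈ P, p ≠ q → Disjoint p q) ∧ (∀ p ∈ P, p.Nonempty) ∧
        ⋃₀ P = Set.univ ∧ (∀ p ∈ P, PolishSpace p) ∧ #P = c} ∧
    ((#α).ord.cof = ℵ₀ →
      Order.succ (#α) ≤ sInf {c : Cardinal | ∃ P : Set (Set (ℕ → α)),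
        (∀ p ∈ P, ∀ q ∈ P, p ≠ q → Disjoint p q) ∧ (∀ p ∈ P, p.Nonempty) ∧
        ⋃₀ P = Set.univ ∧ (∀ p ∈ P, PolishSpace p) ∧ #P = c}) := by
  refine ⟨fun P _ _ hU hP => stmt_first hα P hU hP, ?_, fun hcof => ?_⟩
  · refine le_csInf stmt_nonempty ?_
    rintro _ ⟨P, -, -, hU, hP, rfl⟩
    exact stmt_first hα P hU fun p hp => (hP p hp).toSecondCountableTopology
  · refine le_csInf stmt_nonempty ?_
    rintro _ ⟨P, -, -, hU, hP, rfl⟩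
    exact Order.succ_le_of_lt
      (stmt_diag hα hcof P hU fun p hp => (hP p hp).toSecondCountableTopology)
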